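/- Let N ≥ 3 be an integer. For every smooth compactly supported function φ : ℝᴺ → ℝ one has ‖φ‖_{2N/(N−2)} ≤ C_N · ‖∇φ‖_2, where C_N = ‖F_{1,0}‖_{2N/(N−2)} / ‖∇F_{1,0}‖_2 and F_{t,x₀}(x) = (t/(1+t²|x−x₀|²))^{(N−2)/2}. -/

import Mathlib

open MeasureTheory

noncomputable section

/-- The Sobolev extremal (Aubin–Talenti bubble)
`F_{t,x₀}(x) = (t / (1 + t²|x−x₀|²))^{(N−2)/2}` on `ℝᴺ`. -/
def sobolevBubble (N : ℕ) (t : ℝ) (x₀ : EuclideanSpace ℝ (Fin N)) :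
    EuclideanSpace ℝ (Fin N) → ℝ :=
  fun x => (t / (1 + t ^ 2 * ‖x - x₀‖ ^ 2)) ^ (((N : ℝ) - 2) / 2)

/-- The `L^q` norm (w.r.t. Lebesgue measure) of a real-valued function on `ℝᴺ`. -/
def LqNorm (N : ℕ) (q : ℝ) (φ : EuclideanSpace ℝ (Fin N) → ℝ) : ℝ :=
  (∫ x, |φ x| ^ q) ^ (1 / q)

/-- The `L²` norm of the gradient, `‖∇φ‖₂ = (∫ |∇φ|² dx)^{1/2}`. -/
def gradL2 (N : ℕ) (φ : EuclideanSpace ℝ (Fin N) → ℝ) : ℝ :=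
  Real.sqrt (∫ x, ‖gradient φ x‖ ^ 2)

section SSHelpers
open Set Filter Topology


lemma ss_cdf_hasDeriv (p : ℝ → ℝ) (hc : Continuous p) (hi : Integrable p) (t : ℝ) :
    HasStrictDerivAt (fun t => ∫ x in Iic t, p x) (p t) t := by
  have h : (fun t => ∫ x in Iic t, p x) = fun t => (∫ x in Iic (0:ℝ), p x) + ∫ x in (0:ℝ)..t, p x := by
    funext t
    rw [← intervalIntegral.integral_Iic_sub_Iic hi.integrableOn hi.integrableOn]; ring
  rw [h]
  exact (intervalIntegral.integral_hasStrictDerivAt_right (hc.intervalIntegrable _ _)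
    hc.stronglyMeasurable.stronglyMeasurableAtFilter hc.continuousAt).const_add _

lemma ss_cdf_strictMono (p : ℝ → ℝ) (hc : Continuous p) (hp : ∀ x, 0 < p x) (hi : Integrable p) :
    StrictMono (fun t => ∫ x in Iic t, p x) := by
  apply strictMono_of_deriv_pos
  intro t
  rw [(ss_cdf_hasDeriv p hc hi t).hasDerivAt.deriv]
  exact hp t

lemma ss_cdf_top (p : ℝ → ℝ) (hi : Integrable p) :
    Tendsto (fun t => ∫ x in Iic t, p x) atTop (𝓝 (∫ x, p x)) :=
  (aecover_Iic tendsto_id).integral_tendsto_of_countably_generated hi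

lemma ss_cdf_bot (p : ℝ → ℝ) (hi : Integrable p) :
    Tendsto (fun t => ∫ x in Iic t, p x) atBot (𝓝 0) := by
  have h : (fun t => ∫ x in Iic t, p x) = fun t => (∫ x, p x) - ∫ x in Ioi t, p x := by
    funext t
    rw [← intervalIntegral.integral_Iic_add_Ioi (b := t) hi.integrableOn hi.integrableOn]; ring
  rw [h]
  have := (aecover_Ioi (μ := volume) (tendsto_id (α := ℝ) (x := atBot))).integral_tendsto_of_countably_generated hi
  simpa using (tendsto_const_nhds (x := ∫ x, p x)).sub this

lemma ss_cdf_mem (p : ℝ → ℝ) (hc : Continuous p) (hp : ∀ x, 0 < p x) (hi : Integrable p) (t : ℝ) :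
    0 < (∫ x in Iic t, p x) ∧ (∫ x in Iic t, p x) < ∫ x, p x := by
  have hm := ss_cdf_strictMono p hc hp hi
  constructor
  · have h1 : 0 ≤ ∫ x in Iic (t-1), p x := integral_nonneg (fun x => (hp x).le)
    exact h1.trans_lt (hm (by linarith : t - 1 < t))
  · have h1 : (∫ x in Iic (t+1), p x) ≤ ∫ x, p x :=
      hm.monotone.ge_of_tendsto (ss_cdf_top p hi) _
    exact (hm (by linarith : t < t + 1)).trans_le h1

lemma ss_cdf_surj (p : ℝ → ℝ) (hc : Continuous p) (hi : Integrable p) (c : ℝ)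
    (h0 : 0 < c) (h1 : c < ∫ x, p x) : ∃ t, (∫ x in Iic t, p x) = c := by
  have hcont : Continuous (fun t => ∫ x in Iic t, p x) :=
    continuous_iff_continuousAt.2 fun t => (ss_cdf_hasDeriv p hc hi t).hasDerivAt.continuousAt
  have := mem_range_of_exists_le_of_exists_ge hcont (c := c)
    (((ss_cdf_bot p hi).eventually (gt_mem_nhds h0)).exists.imp fun _ h => le_of_lt h)
    (((ss_cdf_top p hi).eventually (lt_mem_nhds h1)).exists.imp fun _ h => le_of_lt h)
  simpa using this

lemma ss_int_pos (p : ℝ → ℝ) (hc : Continuous p) (hp : ∀ x, 0 < p x) (hi : Integrable p) :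
    0 < ∫ x, p x := (ss_cdf_mem p hc hp hi 0).1.trans (ss_cdf_mem p hc hp hi 0).2

lemma ss_oneD (p q : ℝ → ℝ) (hpc : Continuous p) (hp : ∀ x, 0 < p x) (hpi : Integrable p)
    (hqc : Continuous q) (hq : ∀ x, 0 < q x) (hqi : Integrable q) (τ : ℝ → ℝ)
    (hτ : ∀ t, (∫ x in Iic (τ t), q x) * (∫ x, p x) = (∫ x in Iic t, p x) * ∫ x, q x) :
    (∀ t, HasDerivAt τ ((p t * ∫ x, q x) / (q (τ t) * ∫ x, p x)) t) ∧
    (∀ χ : ℝ → ENNReal, 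
      ∫⁻ t, χ (τ t) * ENNReal.ofReal (p t) =
        ENNReal.ofReal ((∫ x, p x) / ∫ x, q x) * ∫⁻ s, χ s * ENNReal.ofReal (q s)) := by
  have hP := ss_int_pos p hpc hp hpi
  have hQ := ss_int_pos q hqc hq hqi
  have hPm := ss_cdf_strictMono p hpc hp hpi
  have hQm := ss_cdf_strictMono q hqc hq hqi
  have hmono : StrictMono τ := by
    intro a b hab
    have h1 := hPm hab
    rw [← hQm.lt_iff_lt]
    have := mul_lt_mul_of_pos_right h1 hQ
    simp only at this
    rw [← hτ, ← hτ] at this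
    exact lt_of_mul_lt_mul_right this hP.le
  have hsurj : Function.Surjective τ := by
    intro s
    obtain ⟨h0, h1⟩ := ss_cdf_mem q hqc hq hqi s
    obtain ⟨t, ht⟩ := ss_cdf_surj p hpc hpi ((∫ x in Iic s, q x) * (∫ x, p x) / ∫ x, q x)
      (by positivity) (by rw [div_lt_iff₀ hQ]; nlinarith)
    refine ⟨t, hQm.injective ?_⟩
    have := hτ t
    rw [ht, div_mul_cancel₀ _ hQ.ne'] at this
    exact mul_right_cancel₀ hP.ne' this
  have hcont : Continuous τ := hmono.monotone.continuous_of_surjective hsurj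
  have hder : ∀ t, HasDerivAt τ ((p t * ∫ x, q x) / (q (τ t) * ∫ x, p x)) t := by
    intro t
    have hs := ss_cdf_hasDeriv q hqc hqi (τ t)
    have hne := (hq (τ t)).ne'
    have hL := (hs.to_localInverse hne).hasDerivAt
    have hev := hs.hasStrictFDerivAt_equiv hne |>.eventually_left_inverse
    have hev2 := hcont.continuousAt.eventually hev
    have hτ' : ∀ t, (∫ x in Iic (τ t), q x) = (∫ x in Iic t, p x) * ((∫ x, q x) / ∫ x, p x) := by
      intro t
      have := hτ t
      field_simp
      linarith
    have hd : HasDerivAt (fun t => ∫ x in Iic (τ t), q x) (p t * ((∫ x, q x) / ∫ x, p x)) t := by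
      have := (ss_cdf_hasDeriv p hpc hpi t).hasDerivAt.mul_const ((∫ x, q x) / ∫ x, p x)
      exact this.congr_of_eventuallyEq (Eventually.of_forall fun t => hτ' t)
    have hcomp := HasDerivAt.comp t hL hd
    refine (hcomp.congr_of_eventuallyEq ?_).congr_deriv ?_
    · filter_upwards [hev2] with y hy using hy.symm
    · have := hq (τ t); field_simp
  refine ⟨hder, ?_⟩
  intro χ
  have hcv := lintegral_image_eq_lintegral_deriv_mul_of_monotoneOn (s := univ) MeasurableSet.univ
    (fun x _ => (hder x).hasDerivWithinAt) (hmono.monotone.monotoneOn _)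
    (fun s => χ s * ENNReal.ofReal (q s))
  rw [image_univ, hsurj.range_eq] at hcv
  simp only [setLIntegral_univ] at hcv
  rw [hcv, ← lintegral_const_mul' _ _ ENNReal.ofReal_ne_top]
  congr 1
  funext t
  have : p t = (∫ x, p x) / (∫ x, q x) * ((p t * ∫ x, q x) / (q (τ t) * ∫ x, p x)) * q (τ t) := by
    have := hq (τ t); field_simp
  have h2 : ENNReal.ofReal (p t) = ENNReal.ofReal ((∫ x, p x) / (∫ x, q x)) *
      ENNReal.ofReal ((p t * ∫ x, q x) / (q (τ t) * ∫ x, p x)) * ENNReal.ofReal (q (τ t)) := by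
    have h1 := hq (τ t)
    have h3 := hp t
    rw [← ENNReal.ofReal_mul (by positivity), ← ENNReal.ofReal_mul (by positivity), ← this]
  rw [h2]; ring

/-- one-dimensional integration by parts -/
lemma ss_ibp (u u' v v' : ℝ → ℝ) (hu : ∀ t, HasDerivAt u (u' t) t) (hv : ∀ t, HasDerivAt v (v' t) t)
    (hu0 : ∀ t, 0 ≤ u t) (hv0 : ∀ t, 0 ≤ v' t) (hu'c : Continuous u')
    (hw : Integrable (fun t => u t * v t)) :
    ∫⁻ t, ENNReal.ofReal (u t * v' t) ≤ ∫⁻ t, ENNReal.ofReal (|u' t| * |v t|) := by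
  have huc : Continuous u := continuous_iff_continuousAt.2 fun t => (hu t).continuousAt
  have hvc : Continuous v := continuous_iff_continuousAt.2 fun t => (hv t).continuousAt
  by_cases hfin : ∫⁻ t, ENNReal.ofReal (|u' t| * |v t|) = ⊤
  · rw [hfin]; exact le_top
  have hI : Integrable (fun t => |u' t| * |v t|) := by
    refine ⟨(by fun_prop : Continuous fun t => |u' t| * |v t|).aestronglyMeasurable, ?_⟩
    rw [hasFiniteIntegral_iff_ofReal (Eventually.of_forall fun t => by positivity)]
    exact lt_top_iff_ne_top.2 hfin
  rw [← ofReal_integral_eq_lintegral_ofReal hI (Eventually.of_forall fun t => by positivity)]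
  -- small values of w
  have hsmall : ∀ ε > 0, ∀ M : ℝ, (∃ b ≥ M, |u b * v b| < ε) ∧ (∃ a ≤ M, |u a * v a| < ε) := by
    intro ε hε M
    have hmeas : volume {x | ε ≤ ‖u x * v x‖} < ⊤ := hw.measure_norm_ge_lt_top hε
    constructor
    · by_contra! h
      have : Ici M ⊆ {x | ε ≤ ‖u x * v x‖} := fun x hx => by simpa using h x hx
      have := (measure_mono this).trans_lt hmeas
      simp at this
    · by_contra! h
      have : Iic M ⊆ {x | ε ≤ ‖u x * v x‖} := fun x hx => by simpa using h x hx
      have := (measure_mono this).trans_lt hmeas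
      simp at this
  have hv'int : ∀ a b, IntervalIntegrable v' volume a b := by
    intro a b
    apply intervalIntegral.intervalIntegrable_deriv_of_nonneg hvc.continuousOn (fun x _ => hv x) (fun x _ => hv0 x)
  have huvint : ∀ a b, IntervalIntegrable (fun t => u t * v' t) volume a b := fun a b =>
    (hv'int a b).continuousOn_mul huc.continuousOn
  have hu'vint : ∀ a b, IntervalIntegrable (fun t => u' t * v t) volume a b := fun a b =>
    (by fun_prop : Continuous fun t => u' t * v t).intervalIntegrable _ _
  have key : ∀ ε > 0, ∀ n : ℕ, ∫⁻ t in Icc (-(n:ℝ)) n, ENNReal.ofReal (u t * v' t) ≤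
      ENNReal.ofReal (ε + ∫ t, |u' t| * |v t|) := by
    intro ε hε n
    obtain ⟨b, hb, hb'⟩ := (hsmall (ε/2) (by positivity) n).1
    obtain ⟨a, ha, ha'⟩ := (hsmall (ε/2) (by positivity) (-n)).2
    have hn : (0:ℝ) ≤ n := n.cast_nonneg
    have hab : a ≤ b := by linarith
    calc _ ≤ ∫⁻ t in Icc a b, ENNReal.ofReal (u t * v' t) :=
          lintegral_mono_set (Icc_subset_Icc ha hb)
      _ = ENNReal.ofReal (∫ t in Icc a b, u t * v' t) := by
          rw [ofReal_integral_eq_lintegral_ofReal]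
          · exact (intervalIntegrable_iff_integrableOn_Icc_of_le hab).1 (huvint a b)
          · exact Eventually.of_forall fun t => mul_nonneg (hu0 t) (hv0 t)
      _ ≤ _ := by
          apply ENNReal.ofReal_le_ofReal
          rw [integral_Icc_eq_integral_Ioc, ← intervalIntegral.integral_of_le hab]
          rw [intervalIntegral.integral_mul_deriv_eq_deriv_mul (fun x _ => hu x) (fun x _ => hv x)
            (hu'c.intervalIntegrable _ _) (hv'int a b)]
          have h1 : |∫ t in a..b, u' t * v t| ≤ ∫ t, |u' t| * |v t| := by
            calc _ ≤ ∫ t in a..b, |u' t * v t| := intervalIntegral.abs_integral_le_integral_abs hab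
              _ ≤ _ := by
                simp_rw [abs_mul]
                rw [intervalIntegral.integral_of_le hab]
                exact setIntegral_le_integral hI (Eventually.of_forall fun t => by positivity)
          have := abs_le.1 h1
          have := abs_lt.1 hb'
          have := abs_lt.1 ha'
          linarith
  have key2 : ∀ ε > 0, ∫⁻ t, ENNReal.ofReal (u t * v' t) ≤ ENNReal.ofReal (ε + ∫ t, |u' t| * |v t|) := by
    intro ε hε
    have hm : AEMeasurable (fun t => ENNReal.ofReal (u t * v' t)) volume := by
      have : v' = deriv v := by funext t; exact (hv t).deriv.symm
      rw [this]
      exact ((huc.measurable.mul (measurable_deriv v)).ennreal_ofReal).aemeasurable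
    have hcov : AECover volume atTop (fun n : ℕ => Icc (-(n:ℝ)) n) :=
      aecover_Icc (tendsto_neg_atTop_atBot.comp tendsto_natCast_atTop_atTop) tendsto_natCast_atTop_atTop
    exact le_of_tendsto (hcov.lintegral_tendsto_of_countably_generated hm) (Eventually.of_forall fun n => key ε hε n)
  have hlim : Tendsto (fun ε : ℝ => ENNReal.ofReal (ε + ∫ t, |u' t| * |v t|)) (𝓝[>] 0)
      (𝓝 (ENNReal.ofReal (0 + ∫ t, |u' t| * |v t|))) := by
    apply Tendsto.mono_left _ nhdsWithin_le_nhds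
    exact (ENNReal.continuous_ofReal.comp (by fun_prop)).tendsto 0
  rw [zero_add] at hlim
  exact ge_of_tendsto hlim (eventually_mem_nhdsWithin.mono fun ε hε => key2 ε hε)


def ssNice (n : ℕ) (f : (Fin n → ℝ) → ℝ) : Prop :=
  Continuous f ∧ (∀ x, 0 < f x) ∧ ∃ C : ℝ, ∀ x, f x ≤ C * ∏ i, (1 + x i ^ 2)⁻¹

lemma ss_tonelli {n : ℕ} (k : Fin (n+1)) (h : (Fin (n+1) → ℝ) → ENNReal) (hh : Measurable h) :
    ∫⁻ x, h x = ∫⁻ x : Fin n → ℝ, ∫⁻ t : ℝ, h (Fin.insertNth k t x) := by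
  have e := (volume_preserving_piFinSuccAbove (fun _ : Fin (n + 1) => ℝ) k).symm
  rw [← e.lintegral_comp hh]
  have hm : Measurable fun a => h ((MeasurableEquiv.piFinSuccAbove (fun _ : Fin (n + 1) => ℝ) k).symm a) :=
    hh.comp (MeasurableEquiv.measurable _)
  rw [Measure.volume_eq_prod, lintegral_prod_symm' _ hm]
  rfl

lemma ss_tonelli0 {n : ℕ} (h : (Fin (n+1) → ℝ) → ENNReal) (hh : Measurable h) :
    ∫⁻ x, h x = ∫⁻ x : Fin n → ℝ, ∫⁻ t : ℝ, h (Fin.cons t x) := by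
  rw [ss_tonelli 0 h hh]
  simp only [Fin.insertNth_zero']

lemma ss_cont_cons {n : ℕ} : Continuous (fun z : ℝ × (Fin n → ℝ) => (Fin.cons z.1 z.2 : Fin (n+1) → ℝ)) := by
  refine continuous_pi fun i => ?_
  refine Fin.cases ?_ (fun j => ?_) i
  · simpa using continuous_fst
  · simp only [Fin.cons_succ]; fun_prop

lemma ssNice.slice_bound {n : ℕ} {f : (Fin (n+1) → ℝ) → ℝ} (hf : ssNice (n+1) f) : ∃ C : ℝ, 0 ≤ C ∧ ∀ t x, f (Fin.cons t x) ≤ C * (∏ i, (1 + x i ^ 2)⁻¹) * (1 + t^2)⁻¹ := by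
  obtain ⟨_, hp, C, hC⟩ := hf
  refine ⟨C, ?_, ?_⟩
  · have := (hp 0).trans_le (hC 0)
    simp at this
    exact this.le
  intro t x
  have := hC (Fin.cons t x)
  rw [Fin.prod_univ_succ] at this
  simp only [Fin.cons_zero, Fin.cons_succ] at this
  calc _ ≤ _ := this
    _ = _ := by ring

lemma ssNice.slice_cont {n : ℕ} {f : (Fin (n+1) → ℝ) → ℝ} (hf : ssNice (n+1) f) (x : Fin n → ℝ) : Continuous fun t => f (Fin.cons t x) :=
  hf.1.comp (ss_cont_cons.comp (by fun_prop : Continuous fun t : ℝ => (t, x)))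

lemma ssNice.slice_int {n : ℕ} {f : (Fin (n+1) → ℝ) → ℝ} (hf : ssNice (n+1) f) (x : Fin n → ℝ) : Integrable fun t => f (Fin.cons t x) := by
  obtain ⟨C, hC0, hC⟩ := hf.slice_bound
  refine Integrable.mono' (integrable_inv_one_add_sq.const_mul (C * (∏ i, (1 + x i ^ 2)⁻¹)))
    (hf.slice_cont x).aestronglyMeasurable (Eventually.of_forall fun t => ?_)
  rw [Real.norm_of_nonneg (hf.2.1 _).le]
  exact hC t x

lemma ssNice.marg {n : ℕ} {f : (Fin (n+1) → ℝ) → ℝ} (hf : ssNice (n+1) f) : ssNice n (fun x => ∫ t, f (Fin.cons t x)) := by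
  obtain ⟨C, hC0, hC⟩ := hf.slice_bound
  have hprod : ∀ x : Fin n → ℝ, ∏ i, (1 + x i ^ 2)⁻¹ ≤ 1 := fun x => by
    apply Finset.prod_le_one
    · intro i _; positivity
    · intro i _; apply inv_le_one_of_one_le₀; nlinarith [sq_nonneg (x i)]
  refine ⟨?_, ?_, C * Real.pi, ?_⟩
  · refine continuous_of_dominated (bound := fun t => C * (1 + t^2)⁻¹)
      (fun x => (hf.slice_cont x).aestronglyMeasurable) (fun x => Eventually.of_forall fun t => ?_)
      (integrable_inv_one_add_sq.const_mul C) (Eventually.of_forall fun t => ?_)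
    · rw [Real.norm_of_nonneg (hf.2.1 _).le]
      refine (hC t x).trans ?_
      gcongr
      exact mul_le_of_le_one_right hC0 (hprod x)
    · exact hf.1.comp (ss_cont_cons.comp (by fun_prop : Continuous fun x : Fin n → ℝ => (t, x)))
  · intro x
    exact ss_int_pos _ (hf.slice_cont x) (fun t => hf.2.1 _) (hf.slice_int x)
  · intro x
    calc _ ≤ ∫ t : ℝ, C * (∏ i, (1 + x i ^ 2)⁻¹) * (1 + t^2)⁻¹ :=
          integral_mono (hf.slice_int x) (integrable_inv_one_add_sq.const_mul _) (fun t => hC t x)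
      _ = _ := by rw [integral_const_mul, integral_univ_inv_one_add_sq]; ring

lemma ssNice.marg_lintegral {n : ℕ} {f : (Fin (n+1) → ℝ) → ℝ} (hf : ssNice (n+1) f) (x : Fin n → ℝ) :
    ENNReal.ofReal (∫ t, f (Fin.cons t x)) = ∫⁻ t, ENNReal.ofReal (f (Fin.cons t x)) :=
  ofReal_integral_eq_lintegral_ofReal (hf.slice_int x) (Eventually.of_forall fun t => (hf.2.1 _).le)

lemma ssNice.cdf_meas {n : ℕ} {f : (Fin (n+1) → ℝ) → ℝ} (hf : ssNice (n+1) f) : Measurable fun z : (Fin n → ℝ) × ℝ => ∫ t in Iic z.2, f (Fin.cons t z.1) := by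
  have h : (fun z : (Fin n → ℝ) × ℝ => ∫ t in Iic z.2, f (Fin.cons t z.1)) =
      fun z => ∫ t, ({w : ((Fin n → ℝ) × ℝ) × ℝ | w.2 ≤ w.1.2}.indicator
        (fun w => f (Fin.cons w.2 w.1.1))) (z, t) := by
    funext z
    rw [← integral_indicator measurableSet_Iic]
    rfl
  rw [h]
  have hm : Measurable ({w : ((Fin n → ℝ) × ℝ) × ℝ | w.2 ≤ w.1.2}.indicator
        (fun w => f (Fin.cons w.2 w.1.1))) := by
    apply Measurable.indicator
    · exact (hf.1.comp (ss_cont_cons.comp (by fun_prop : Continuous fun w : ((Fin n → ℝ) × ℝ) × ℝ => (w.2, w.1.1)))).measurable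
    · exact measurableSet_le (by fun_prop) (by fun_prop)
  exact (StronglyMeasurable.integral_prod_right' hm.stronglyMeasurable).measurable

theorem ss_knothe (n : ℕ) : ∀ (f g : (Fin n → ℝ) → ℝ), ssNice n f → ssNice n g →
    (∫⁻ x, ENNReal.ofReal (f x) = ∫⁻ x, ENNReal.ofReal (g x)) →
    ∃ (T D : (Fin n → ℝ) → (Fin n → ℝ)), Measurable T ∧ Measurable D ∧ (∀ x k, 0 < D x k) ∧
      (∀ x k, HasDerivAt (fun t => T (Function.update x k t) k) (D x k) (x k)) ∧
      (∀ x, f x = g (T x) * ∏ k, D x k) ∧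
      (∀ ψ : (Fin n → ℝ) → ENNReal, Measurable ψ →
        ∫⁻ x, ψ (T x) * ENNReal.ofReal (f x) = ∫⁻ y, ψ y * ENNReal.ofReal (g y)) := by
  induction n with
  | zero =>
    intro f g hf hg hfg
    have hx : ∀ x : Fin 0 → ℝ, x = default := fun x => Subsingleton.elim _ _
    have hE : ∀ x, f x = g x := by
      intro x
      rw [volume_pi, Measure.pi_of_empty _ default, lintegral_dirac, lintegral_dirac] at hfg
      rw [hx x]
      exact (ENNReal.ofReal_eq_ofReal_iff (hf.2.1 _).le (hg.2.1 _).le).1 hfg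
    refine ⟨id, id, measurable_id, measurable_id, fun x k => k.elim0, fun x k => k.elim0,
      fun x => by simp [hE], fun ψ hψ => by simp [hE]⟩
  | succ n ih =>
    intro f g hf hg hfg
    obtain ⟨T, D, hT, hD, hDpos, hTD, hfT, hpush⟩ := ih _ _ hf.marg hg.marg (by
      simp only [hf.marg_lintegral, hg.marg_lintegral]
      rw [← ss_tonelli0 (fun x => ENNReal.ofReal (f x)) hf.1.measurable.ennreal_ofReal,
        ← ss_tonelli0 (fun x => ENNReal.ofReal (g x)) hg.1.measurable.ennreal_ofReal, hfg])
    set fb : (Fin n → ℝ) → ℝ := fun x => ∫ t, f (Fin.cons t x) with hfb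
    set gb : (Fin n → ℝ) → ℝ := fun x => ∫ t, g (Fin.cons t x) with hgb
    have hfbpos : ∀ x, 0 < fb x := hf.marg.2.1
    have hgbpos : ∀ x, 0 < gb x := hg.marg.2.1
    have hex : ∀ x t, ∃ s, (∫ r in Iic s, g (Fin.cons r (T x))) * fb x =
        (∫ r in Iic t, f (Fin.cons r x)) * gb (T x) := by
      intro x t
      obtain ⟨h0, h1⟩ := ss_cdf_mem _ (hf.slice_cont x) (fun t => hf.2.1 _) (hf.slice_int x) t
      have h2 := hgbpos (T x)
      have h3 := hfbpos x
      obtain ⟨s, hs⟩ := ss_cdf_surj _ (hg.slice_cont (T x)) (hg.slice_int (T x))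
        ((∫ r in Iic t, f (Fin.cons r x)) * gb (T x) / fb x) (by positivity)
        (by
          rw [div_lt_iff₀ h3]
          have := mul_lt_mul_of_pos_right h1 h2
          rw [mul_comm (fb x)] at this
          exact this)
      exact ⟨s, by rw [hs]; field_simp⟩
    choose τ hτ using hex
    have h1d := fun x => ss_oneD (fun t => f (Fin.cons t x)) (fun t => g (Fin.cons t (T x)))
      (hf.slice_cont x) (fun t => hf.2.1 _) (hf.slice_int x)
      (hg.slice_cont (T x)) (fun t => hg.2.1 _) (hg.slice_int (T x)) (τ x) (hτ x)
    have hτm : Measurable (fun z : (Fin n → ℝ) × ℝ => τ z.1 z.2) := by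
      apply measurable_of_Iic
      intro s
      have : (fun z : (Fin n → ℝ) × ℝ => τ z.1 z.2) ⁻¹' Iic s =
          {z | (∫ r in Iic z.2, f (Fin.cons r z.1)) * gb (T z.1) ≤
            (∫ r in Iic s, g (Fin.cons r (T z.1))) * fb z.1} := by
        ext z
        simp only [mem_preimage, mem_Iic, Set.mem_ofPred_eq]
        rw [← hτ z.1 z.2, mul_le_mul_iff_left₀ (hfbpos z.1)]
        exact (ss_cdf_strictMono _ (hg.slice_cont (T z.1)) (fun t => hg.2.1 _)
          (hg.slice_int (T z.1))).le_iff_le.symm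
      rw [this]
      have hfbm : Measurable fb := hf.marg.1.measurable
      have hgbm : Measurable gb := hg.marg.1.measurable
      refine measurableSet_le ?_ ?_
      · exact hf.cdf_meas.mul (hgbm.comp (hT.comp measurable_fst))
      · refine Measurable.mul ?_ (hfbm.comp measurable_fst)
        exact hg.cdf_meas.comp (f := fun z : (Fin n → ℝ) × ℝ => (T z.1, s))
          ((hT.comp measurable_fst).prodMk measurable_const)
    have htail : Measurable (fun x : Fin (n+1) → ℝ => (Fin.tail x : Fin n → ℝ)) :=
      measurable_pi_lambda _ fun i => measurable_pi_apply _
    have hτm' : Measurable (fun x : Fin (n+1) → ℝ => τ (Fin.tail x) (x 0)) :=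
      hτm.comp (htail.prodMk (measurable_pi_apply 0))
    set T' : (Fin (n+1) → ℝ) → (Fin (n+1) → ℝ) :=
      fun x => Fin.cons (τ (Fin.tail x) (x 0)) (T (Fin.tail x)) with hT'
    set D' : (Fin (n+1) → ℝ) → (Fin (n+1) → ℝ) :=
      fun x => Fin.cons ((f x * gb (T (Fin.tail x))) / (g (T' x) * fb (Fin.tail x)))
        (D (Fin.tail x)) with hD'
    have hconsm : Measurable (fun z : ℝ × (Fin n → ℝ) => (Fin.cons z.1 z.2 : Fin (n+1) → ℝ)) :=
      ss_cont_cons.measurable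
    have hT'm : Measurable T' := hconsm.comp (hτm'.prodMk (hT.comp htail))
    have hD'm : Measurable D' := by
      refine hconsm.comp (f := fun x => (_, _)) (Measurable.prodMk ?_ (hD.comp htail))
      exact (hf.1.measurable.mul (hg.marg.1.measurable.comp (hT.comp htail))).div
        ((hg.1.measurable.comp hT'm).mul (hf.marg.1.measurable.comp htail))
    refine ⟨T', D', hT'm, hD'm, ?_, ?_, ?_, ?_⟩
    · intro x k
      refine Fin.cases ?_ (fun j => ?_) k
      · have h1 := hf.2.1 x
        have h2 := hg.2.1 (T' x)
        have h3 := hfbpos (Fin.tail x)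
        have h4 := hgbpos (T (Fin.tail x))
        simp only [hD', Fin.cons_zero]
        positivity
      · simpa [hD'] using hDpos _ _
    · intro x k
      refine Fin.cases ?_ (fun j => ?_) k
      · simp only [hT', hD', Fin.cons_zero, Fin.tail_update_zero, Function.update_self]
        have := (h1d (Fin.tail x)).1 (x 0)
        rw [Fin.cons_self_tail] at this
        exact this
      · simp only [hT', hD', Fin.cons_succ, Fin.tail_update_succ]
        exact hTD (Fin.tail x) j
    · intro x
      rw [Fin.prod_univ_succ]
      simp only [hD', Fin.cons_zero, Fin.cons_succ]
      have h2 := hg.2.1 (T' x)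
      have h3 := hfbpos (Fin.tail x)
      have h4 := hgbpos (T (Fin.tail x))
      have h5 : fb (Fin.tail x) = gb (T (Fin.tail x)) * _ := hfT (Fin.tail x)
      set P := ∏ k, D (Fin.tail x) k
      field_simp
      rw [h5]; ring
    · intro ψ hψ
      have hgm : Measurable fun y => ENNReal.ofReal (g y) := hg.1.measurable.ennreal_ofReal
      have hfm : Measurable fun y => ENNReal.ofReal (f y) := hf.1.measurable.ennreal_ofReal
      rw [ss_tonelli0 (fun x => ψ (T' x) * ENNReal.ofReal (f x)) ((hψ.comp hT'm).mul hfm),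
        ss_tonelli0 (fun y => ψ y * ENNReal.ofReal (g y)) (hψ.mul hgm)]
      set Ψ : (Fin n → ℝ) → ENNReal := fun y =>
        ENNReal.ofReal (1 / gb y) * ∫⁻ s, ψ (Fin.cons s y) * ENNReal.ofReal (g (Fin.cons s y)) with hΨ
      have hΨm : Measurable Ψ := by
        refine Measurable.mul ?_ ?_
        · exact (measurable_const.div hg.marg.1.measurable).ennreal_ofReal
        · refine Measurable.lintegral_prod_right' (f := fun z : (Fin n → ℝ) × ℝ =>
            ψ (Fin.cons z.2 z.1) * ENNReal.ofReal (g (Fin.cons z.2 z.1))) ?_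
          exact (hψ.mul hgm).comp (hconsm.comp measurable_swap)
      have := hpush Ψ hΨm
      calc _ = ∫⁻ x, Ψ (T x) * ENNReal.ofReal (fb x) := by
            refine lintegral_congr fun x => ?_
            have h := (h1d x).2 (fun s => ψ (Fin.cons s (T x)))
            simp only [hT', Fin.cons_zero, Fin.tail_cons]
            rw [h, hΨ]
            simp only
            rw [mul_right_comm, ← ENNReal.ofReal_mul (by have := hgbpos (T x); positivity)]
            congr 2
            simp only [hfb, hgb]; ring
        _ = ∫⁻ y, Ψ y * ENNReal.ofReal (gb y) := this
        _ = _ := by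
            refine lintegral_congr fun y => ?_
            have h := hgbpos y
            rw [hΨ]
            simp only
            rw [mul_right_comm, ← ENNReal.ofReal_mul (by positivity), one_div,
              inv_mul_cancel₀ h.ne', ENNReal.ofReal_one, one_mul]


lemma ss_ibp_k {m : ℕ} (a b : ℝ) (hab : 1 + b = 2 * a) (f : (Fin (m+1) → ℝ) → ℝ) (hf : ssNice (m+1) f)
    (T D U : (Fin (m+1) → ℝ) → (Fin (m+1) → ℝ)) (hT : Measurable T) (hD : Measurable D)
    (k : Fin (m+1)) (hDpos : ∀ x, 0 < D x k)
    (hTD : ∀ x, HasDerivAt (fun t => T (Function.update x k t) k) (D x k) (x k))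
    (hUD : ∀ x, HasDerivAt (fun t => f (Function.update x k t) ^ a) (U x k) (x k))
    (hU : Continuous U)
    (hline : ∀ x : Fin m → ℝ, Integrable (fun t => f (Fin.insertNth k t x : Fin (m+1) → ℝ) ^ b))
    (hfin : ∫⁻ x, ENNReal.ofReal (T x k ^ 2 * f x) ≠ ⊤) :
    ∫⁻ x, ENNReal.ofReal (f x ^ a * D x k) ≤ ∫⁻ x, ENNReal.ofReal (|U x k| * |T x k|) := by
  have hTk : Measurable fun x => T x k := (measurable_pi_apply k).comp hT
  have hDk : Measurable fun x => D x k := (measurable_pi_apply k).comp hD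
  have hUk : Continuous fun x => U x k := (continuous_apply k).comp hU
  have hfm := hf.1.measurable
  have hinsc : ∀ x : Fin m → ℝ, Continuous fun t : ℝ => (Fin.insertNth k t x : Fin (m+1) → ℝ) := by
    intro x
    exact Continuous.finInsertNth k continuous_id continuous_const
  have hm1 : Measurable fun x => ENNReal.ofReal (T x k ^ 2 * f x) := by fun_prop
  rw [ss_tonelli k _ (by fun_prop), ss_tonelli k _ (by have := hUk.measurable; fun_prop)]
  rw [ss_tonelli k _ hm1] at hfin
  have hae := ae_lt_top (μ := (volume : Measure (Fin m → ℝ)))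
    (f := fun x => ∫⁻ t, ENNReal.ofReal (T (Fin.insertNth k t x) k ^ 2 * f (Fin.insertNth k t x)))
    (by
      refine Measurable.lintegral_prod_left' (f := fun z : ℝ × (Fin m → ℝ) => ENNReal.ofReal (T (Fin.insertNth k z.1 z.2) k ^ 2 * f (Fin.insertNth k z.1 z.2))) ?_
      exact hm1.comp (MeasurableEquiv.piFinSuccAbove (fun _ : Fin (m + 1) => ℝ) k).symm.measurable) hfin
  refine lintegral_mono_ae ?_
  filter_upwards [hae] with x hx
  have hdT : ∀ t, HasDerivAt (fun t => T (Fin.insertNth k t x) k) (D (Fin.insertNth k t x) k) t := by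
    intro t
    have := hTD (Fin.insertNth k t x)
    simpa only [Fin.update_insertNth, Fin.insertNth_apply_same] using this
  have hdU : ∀ t, HasDerivAt (fun t => f (Fin.insertNth k t x) ^ a) (U (Fin.insertNth k t x) k) t := by
    intro t
    have := hUD (Fin.insertNth k t x)
    simpa only [Fin.update_insertNth, Fin.insertNth_apply_same] using this
  have hTc : Continuous (fun t => T (Fin.insertNth k t x) k) :=
    continuous_iff_continuousAt.2 fun t => (hdT t).continuousAt
  have huc : Continuous (fun t => f (Fin.insertNth k t x) ^ a) :=
    continuous_iff_continuousAt.2 fun t => (hdU t).continuousAt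
  refine ss_ibp _ _ _ _ hdU hdT (fun t => Real.rpow_nonneg (hf.2.1 _).le _) (fun t => (hDpos _).le)
    (hUk.comp (hinsc x)) ?_
  have hI : Integrable fun t => T (Fin.insertNth k t x) k ^ 2 * f (Fin.insertNth k t x) := by
    have hfc := hf.1.comp (hinsc x)
    refine ⟨((hTc.pow 2).mul hfc).aestronglyMeasurable, ?_⟩
    rw [hasFiniteIntegral_iff_ofReal (Eventually.of_forall fun t => mul_nonneg (sq_nonneg _) (hf.2.1 _).le)]
    exact hx
  refine Integrable.mono' (hI.add (hline x)) (huc.mul hTc).aestronglyMeasurable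
    (Eventually.of_forall fun t => ?_)
  simp only [Pi.add_apply]
  set z : Fin (m+1) → ℝ := Fin.insertNth k t x
  have hz := hf.2.1 z
  rw [Real.norm_eq_abs, abs_mul, abs_of_pos (Real.rpow_pos_of_pos hz _)]
  have h1 : f z ^ b * f z = (f z ^ a) ^ 2 := by
    rw [← Real.rpow_natCast, ← Real.rpow_mul hz.le]
    nth_rw 2 [← Real.rpow_one (f z)]
    rw [← Real.rpow_add hz]
    congr 1
    push_cast; linarith
  have h2 := Real.rpow_pos_of_pos hz b
  have h3 := Real.rpow_pos_of_pos hz a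
  have h4 : (f z ^ a * |T z k|)^2 = (T z k ^2 * f z) * f z ^ b := by
    rw [mul_pow, ← h1, sq_abs]; ring
  have h5 : 0 ≤ T z k ^2 * f z := by positivity
  nlinarith [sq_nonneg (T z k ^2 * f z - f z ^ b), mul_nonneg h5 h2.le, mul_nonneg h3.le (abs_nonneg (T z k))]

theorem ss_core {m : ℕ} (f g : (Fin (m+1) → ℝ) → ℝ) (hf : ssNice (m+1) f) (hg : ssNice (m+1) g)
    (hfg : ∫⁻ x, ENNReal.ofReal (f x) = ∫⁻ x, ENNReal.ofReal (g x))
    (U : (Fin (m+1) → ℝ) → (Fin (m+1) → ℝ)) (hU : Continuous U) (c : ℝ) (hc : c = 1 / ((m+1 : ℕ) : ℝ))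
    (hUD : ∀ x k, HasDerivAt (fun t => f (Function.update x k t) ^ (1 - c)) (U x k) (x k))
    (hline : ∀ (k : Fin (m+1)) (x : Fin m → ℝ), Integrable (fun t => f (Fin.insertNth k t x : Fin (m+1) → ℝ) ^ (1 - 2 * c)))
    (hfin : ∫⁻ x, ENNReal.ofReal ((∑ k, x k ^ 2) * g x) ≠ ⊤) :
    ((m+1 : ℕ) : ENNReal) * ∫⁻ x, ENNReal.ofReal (g x ^ (1 - c)) ≤
      (∫⁻ x, ENNReal.ofReal ((∑ k, U x k ^ 2) / f x)) ^ (1/2 : ℝ) *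
      (∫⁻ x, ENNReal.ofReal ((∑ k, x k ^ 2) * g x)) ^ (1/2 : ℝ) := by
  obtain ⟨T, D, hT, hD, hDpos, hTD, hfT, hpush⟩ := ss_knothe (m+1) f g hf hg hfg
  have hn0 : (0:ℝ) < ((m+1 : ℕ) : ℝ) := by positivity
  have hTk : ∀ k, Measurable fun x => T x k := fun k => (measurable_pi_apply k).comp hT
  have hDk : ∀ k, Measurable fun x => D x k := fun k => (measurable_pi_apply k).comp hD
  have hUk : ∀ k, Measurable fun x => U x k := fun k => ((continuous_apply k).comp hU).measurable
  have hfm := hf.1.measurable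
  have hgm := hg.1.measurable
  have hpushM : ∫⁻ x, ENNReal.ofReal ((∑ k, T x k ^ 2) * f x) = ∫⁻ x, ENNReal.ofReal ((∑ k, x k ^ 2) * g x) := by
    have := hpush (fun y => ENNReal.ofReal (∑ k, y k ^ 2)) (by fun_prop)
    simp only [← ENNReal.ofReal_mul (Finset.sum_nonneg fun i _ => sq_nonneg _)] at this
    exact this
  have hA : ∫⁻ x, ENNReal.ofReal (g x ^ (1 - c)) = ∫⁻ x, ENNReal.ofReal (g (T x) ^ (-c) * f x) := by
    have := hpush (fun y => ENNReal.ofReal (g y ^ (-c))) (by fun_prop)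
    simp only [← ENNReal.ofReal_mul (Real.rpow_nonneg (hg.2.1 _).le _)] at this
    rw [this]
    refine lintegral_congr fun y => ?_
    have hy := hg.2.1 y
    rw [sub_eq_add_neg, Real.rpow_add hy, Real.rpow_one, mul_comm]
  have hpt : ∀ x, ((m+1 : ℕ) : ℝ) * (g (T x) ^ (-c) * f x) ≤ ∑ k, f x ^ (1 - c) * D x k := by
    intro x
    have hx := hf.2.1 x
    have hy := hg.2.1 (T x)
    have hP : 0 < ∏ k, D x k := Finset.prod_pos fun k _ => hDpos x k
    have hag := Real.geom_mean_le_arith_mean_weighted Finset.univ (fun _ : Fin (m+1) => c) (fun k => D x k)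
      (fun i _ => by rw [hc]; positivity) (by simp [hc]; field_simp) (fun i _ => (hDpos x i).le)
    rw [Real.finset_prod_rpow _ _ (fun i _ => (hDpos x i).le), ← Finset.mul_sum] at hag
    have h1 : g (T x) ^ (-c) * f x = f x ^ (1-c) * (∏ k, D x k) ^ c := by
      have : f x ^ c = g (T x) ^ c * (∏ k, D x k) ^ c := by
        rw [hfT x, Real.mul_rpow hy.le hP.le]
      rw [Real.rpow_sub hx, Real.rpow_one, this, Real.rpow_neg hy.le]
      have := Real.rpow_pos_of_pos hy c
      have := Real.rpow_pos_of_pos hP c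
      field_simp
    rw [h1, ← Finset.mul_sum]
    have h2 := mul_le_mul_of_nonneg_left hag (mul_nonneg hn0.le (Real.rpow_pos_of_pos hx (1-c)).le)
    calc _ = ((m+1 : ℕ) : ℝ) * f x ^ (1-c) * (∏ k, D x k) ^ c := by ring
      _ ≤ _ := h2
      _ = _ := by rw [hc]; field_simp
  have hibp : ∀ k, ∫⁻ x, ENNReal.ofReal (f x ^ (1-c) * D x k) ≤ ∫⁻ x, ENNReal.ofReal (|U x k| * |T x k|) := by
    intro k
    refine ss_ibp_k (1-c) (1-2*c) (by ring) f hf T D U hT hD k (fun x => hDpos x k) (fun x => hTD x k)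
      (fun x => hUD x k) hU (hline k) ?_
    refine ne_top_of_le_ne_top (hpushM ▸ hfin) (lintegral_mono fun x => ENNReal.ofReal_le_ofReal ?_)
    refine mul_le_mul_of_nonneg_right ?_ (hf.2.1 x).le
    exact Finset.single_le_sum (f := fun k => T x k ^ 2) (fun i _ => sq_nonneg _) (Finset.mem_univ k)
  calc ((m+1 : ℕ) : ENNReal) * ∫⁻ x, ENNReal.ofReal (g x ^ (1 - c))
      = ∫⁻ x, ENNReal.ofReal (((m+1 : ℕ) : ℝ) * (g (T x) ^ (-c) * f x)) := by
        rw [hA, ← lintegral_const_mul' _ _ (ENNReal.natCast_ne_top _)]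
        refine lintegral_congr fun x => ?_
        rw [ENNReal.ofReal_mul hn0.le, ENNReal.ofReal_natCast]
    _ ≤ ∫⁻ x, ∑ k, ENNReal.ofReal (f x ^ (1 - c) * D x k) := by
        refine lintegral_mono fun x => ?_
        rw [← ENNReal.ofReal_sum_of_nonneg]
        · exact ENNReal.ofReal_le_ofReal (hpt x)
        · intro k _; exact mul_nonneg (Real.rpow_nonneg (hf.2.1 _).le _) (hDpos x k).le
    _ = ∑ k, ∫⁻ x, ENNReal.ofReal (f x ^ (1 - c) * D x k) :=
        lintegral_finsetSum _ (fun k _ => by have := hDk k; fun_prop)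
    _ ≤ ∑ k, ∫⁻ x, ENNReal.ofReal (|U x k| * |T x k|) := Finset.sum_le_sum fun k _ => hibp k
    _ = ∫⁻ x, ∑ k, ENNReal.ofReal (|U x k| * |T x k|) :=
        (lintegral_finsetSum _ (fun k _ => by have := hTk k; have := hUk k; fun_prop)).symm
    _ ≤ ∫⁻ x, ENNReal.ofReal (√((∑ k, U x k ^ 2) / f x)) * ENNReal.ofReal (√((∑ k, T x k ^ 2) * f x)) := by
        refine lintegral_mono fun x => ?_
        rw [← ENNReal.ofReal_sum_of_nonneg (fun k _ => by positivity), ← ENNReal.ofReal_mul (Real.sqrt_nonneg _)]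
        apply ENNReal.ofReal_le_ofReal
        have hx := hf.2.1 x
        rw [← Real.sqrt_mul (by positivity)]
        have := Real.sum_mul_le_sqrt_mul_sqrt Finset.univ (fun k => |U x k|) (fun k => |T x k|)
        refine this.trans_eq ?_
        rw [← Real.sqrt_mul (Finset.sum_nonneg fun i _ => sq_nonneg _)]
        congr 1
        simp only [sq_abs]
        field_simp
    _ ≤ (∫⁻ x, ENNReal.ofReal (√((∑ k, U x k ^ 2) / f x)) ^ (2:ℝ)) ^ (1/2 : ℝ) *
        (∫⁻ x, ENNReal.ofReal (√((∑ k, T x k ^ 2) * f x)) ^ (2:ℝ)) ^ (1/2 : ℝ) := by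
        refine ENNReal.lintegral_mul_le_Lp_mul_Lq _ (Real.HolderConjugate.two_two) ?_ ?_
        · refine Measurable.aemeasurable ?_; fun_prop
        · refine Measurable.aemeasurable ?_; fun_prop
    _ = _ := by
        have hsq : ∀ r : ℝ, 0 ≤ r → ENNReal.ofReal (√r) ^ (2:ℝ) = ENNReal.ofReal r := by
          intro r hr
          rw [ENNReal.ofReal_rpow_of_nonneg (Real.sqrt_nonneg _) (by norm_num)]
          congr 1
          rw [Real.rpow_two, Real.sq_sqrt hr]
        rw [← hpushM]
        congr 2
        · refine lintegral_congr fun x => hsq _ ?_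
          have := hf.2.1 x
          positivity
        · refine lintegral_congr fun x => hsq _ ?_
          have := hf.2.1 x
          positivity


lemma ss_nice_of_bound {m : ℕ} (f : (Fin (m+1) → ℝ) → ℝ) (hc : Continuous f) (hp : ∀ x, 0 < f x)
    (C : ℝ) (hC0 : 0 ≤ C) (hC : ∀ x, f x ≤ C * (1 + ∑ k, x k ^ 2) ^ (-((m:ℝ)+1))) : ssNice (m+1) f := by
  refine ⟨hc, hp, C, fun x => (hC x).trans ?_⟩
  refine mul_le_mul_of_nonneg_left ?_ hC0
  have hS : 0 < 1 + ∑ k, x k ^ 2 := by positivity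
  rw [Real.rpow_neg hS.le, Finset.prod_inv_distrib]
  refine inv_anti₀ (Finset.prod_pos fun i _ => by positivity) ?_
  calc ∏ i, (1 + x i ^ 2) ≤ ∏ _i : Fin (m+1), (1 + ∑ k, x k ^ 2) := by
        refine Finset.prod_le_prod (fun i _ => by positivity) (fun i _ => ?_)
        have := Finset.single_le_sum (f := fun k => x k ^ 2) (fun i _ => sq_nonneg _) (Finset.mem_univ i)
        linarith
    _ = _ := by
        rw [Finset.prod_const, ← Real.rpow_natCast]
        simp

theorem ss_pi_eps {m : ℕ} (hm : 2 ≤ m) (φ F : (Fin (m+1) → ℝ) → ℝ)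
    (Gφ GF : (Fin (m+1) → ℝ) → (Fin (m+1) → ℝ)) (hφc : Continuous φ) (hFc : Continuous F)
    (hGφ : Continuous Gφ) (hGF : Continuous GF)
    (hDφ : ∀ x k, HasDerivAt (fun t => φ (Function.update x k t)) (Gφ x k) (x k))
    (hDF : ∀ x k, HasDerivAt (fun t => F (Function.update x k t)) (GF x k) (x k))
    (hF : ∀ x, F x ^ 2 = (1 + ∑ k, x k ^ 2) ^ (-((m:ℝ)-1)))
    (K : ℝ) (hK0 : 0 ≤ K) (hK : ∀ x, φ x ^ 2 ≤ K * F x ^ 2) (ε : ℝ) (hε : 0 < ε) (L : ℝ) (hL : 0 < L)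
    (hint : ∫⁻ x, ENNReal.ofReal (L * (φ x ^ 2 + ε ^ 2 * F x ^ 2) ^ (((m:ℝ)+1)/((m:ℝ)-1))) =
      ∫⁻ x : Fin (m+1) → ℝ, ENNReal.ofReal ((1 + ∑ k, x k ^ 2) ^ (-((m:ℝ)+1))))
    (hfin : ∫⁻ x : Fin (m+1) → ℝ, ENNReal.ofReal ((∑ k, x k ^ 2) * (1 + ∑ k, x k ^ 2) ^ (-((m:ℝ)+1))) ≠ ⊤) :
    ((m+1 : ℕ) : ENNReal) * ∫⁻ x : Fin (m+1) → ℝ, ENNReal.ofReal ((1 + ∑ k, x k ^ 2) ^ (-(m:ℝ))) ≤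
      (∫⁻ x, ENNReal.ofReal (L ^ (((m:ℝ)-1)/((m:ℝ)+1)) * (2*(m:ℝ)/((m:ℝ)-1))^2 *
        ((∑ k, Gφ x k ^ 2) + ε ^ 2 * ∑ k, GF x k ^ 2))) ^ (1/2 : ℝ) *
      (∫⁻ x : Fin (m+1) → ℝ, ENNReal.ofReal ((∑ k, x k ^ 2) * (1 + ∑ k, x k ^ 2) ^ (-((m:ℝ)+1)))) ^ (1/2 : ℝ) := by
  have hm' : (2:ℝ) ≤ m := by exact_mod_cast hm
  obtain ⟨d, hd⟩ : ∃ d : ℝ, d = (m:ℝ) - 1 := ⟨_, rfl⟩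
  have hd1 : 1 ≤ d := by linarith
  have hmd : (m:ℝ) = d + 1 := by linarith
  have hd0 : 0 < d := by linarith
  set S : (Fin (m+1) → ℝ) → ℝ := fun x => 1 + ∑ k, x k ^ 2 with hS
  have hSpos : ∀ x, 0 < S x := fun x => by simp only [hS]; positivity
  have hSc : Continuous S := by simp only [hS]; fun_prop
  set c : ℝ := 1 / ((m+1 : ℕ) : ℝ) with hc
  have hc' : c = 1 / (d + 2) := by rw [hc]; push_cast; rw [hmd]; ring_nf
  set ψ : (Fin (m+1) → ℝ) → ℝ := fun x => φ x ^ 2 + ε ^ 2 * F x ^ 2 with hψ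
  have hF2 : ∀ x, 0 < F x ^ 2 := fun x => by rw [hF]; exact Real.rpow_pos_of_pos (hSpos x) _
  have hψpos : ∀ x, 0 < ψ x := fun x => by have := hF2 x; simp only [hψ]; positivity
  have hψc : Continuous ψ := by simp only [hψ]; fun_prop
  have hψle : ∀ x, ψ x ≤ (K + ε^2) * S x ^ (-d) := fun x => by
    have h1 := hK x
    have h2 := hF x
    rw [← hd] at h2
    simp only [hψ]
    change F x ^ 2 = S x ^ (-d) at h2
    rw [← h2]; nlinarith
  set r : ℝ := ((m:ℝ)+1)/((m:ℝ)-1) with hr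
  have hr' : r = (d+2)/d := by rw [hr, hmd]; ring_nf
  have hr0 : 0 < r := by rw [hr']; positivity
  set f : (Fin (m+1) → ℝ) → ℝ := fun x => L * ψ x ^ r with hf
  have hfc : Continuous f := by
    simp only [hf]
    exact continuous_const.mul (hψc.rpow_const fun x => Or.inl (hψpos x).ne')
  have hfpos : ∀ x, 0 < f x := fun x => mul_pos hL (Real.rpow_pos_of_pos (hψpos x) _)
  have hfle : ∀ x, f x ≤ (L * (K + ε^2) ^ r) * S x ^ (-((m:ℝ)+1)) := fun x => by
    simp only [hf]
    rw [mul_assoc]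
    refine mul_le_mul_of_nonneg_left ?_ hL.le
    refine (Real.rpow_le_rpow (hψpos x).le (hψle x) hr0.le).trans_eq ?_
    rw [Real.mul_rpow (by positivity) (Real.rpow_nonneg (hSpos x).le _), ← Real.rpow_mul (hSpos x).le]
    congr 2
    rw [hr', hmd]; field_simp; ring
  have hfnice : ssNice (m+1) f := ss_nice_of_bound f hfc hfpos _ (by positivity) hfle
  have hgnice : ssNice (m+1) (fun x => S x ^ (-((m:ℝ)+1))) :=
    ss_nice_of_bound _ (hSc.rpow_const fun x => Or.inl (hSpos x).ne')
      (fun x => Real.rpow_pos_of_pos (hSpos x) _) 1 zero_le_one (fun x => by rw [one_mul])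
  set s : ℝ := (d+1)/d with hs
  have hrs : r * (1 - c) = s := by rw [hr', hc', hs]; field_simp; ring
  have hfu : ∀ x, f x ^ (1 - c) = L ^ (1-c) * ψ x ^ s := fun x => by
    simp only [hf]
    rw [Real.mul_rpow hL.le (Real.rpow_nonneg (hψpos x).le _), ← Real.rpow_mul (hψpos x).le, hrs]
  set U : (Fin (m+1) → ℝ) → (Fin (m+1) → ℝ) := fun x k =>
    L ^ (1-c) * ((2 * φ x * Gφ x k + ε ^ 2 * (2 * F x * GF x k)) * s * ψ x ^ (s - 1)) with hU
  have hUc : Continuous U := by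
    refine continuous_pi fun k => ?_
    have h1 : Continuous fun x => ψ x ^ (s-1) := hψc.rpow_const fun x => Or.inl (hψpos x).ne'
    simp only [hU]
    fun_prop
  have hcore := ss_core f (fun x => S x ^ (-((m:ℝ)+1))) hfnice hgnice hint U hUc c hc ?_ ?_ hfin
  · have hg : ∀ x, (S x ^ (-((m:ℝ)+1))) ^ (1 - c) = S x ^ (-(m:ℝ)) := fun x => by
      rw [← Real.rpow_mul (hSpos x).le]
      congr 1
      rw [hc', hmd]; field_simp; ring
    simp only [hg] at hcore
    refine hcore.trans ?_
    gcongr with x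
    have hψx := hψpos x
    have hUk : ∀ k, U x k ^ 2 ≤ (L ^ (1-c) * s * ψ x ^ (s-1))^2 * (4 * ψ x * (Gφ x k ^ 2 + ε^2 * GF x k ^ 2)) := by
      intro k
      have : U x k ^ 2 = (L ^ (1-c) * s * ψ x ^ (s-1))^2 * (2 * φ x * Gφ x k + ε ^ 2 * (2 * F x * GF x k))^2 := by
        simp only [hU]; ring
      rw [this]
      refine mul_le_mul_of_nonneg_left ?_ (sq_nonneg _)
      simp only [hψ]
      nlinarith [mul_nonneg (sq_nonneg ε) (sq_nonneg (φ x * GF x k - F x * Gφ x k))]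
    have hsum := Finset.sum_le_sum (s := Finset.univ) fun k _ => hUk k
    rw [div_le_iff₀ (hfpos x)]
    refine hsum.trans_eq ?_
    rw [← Finset.mul_sum, ← Finset.mul_sum, Finset.sum_add_distrib, ← Finset.mul_sum]
    have e1 : (L ^ (1-c))^2 = L ^ (((m:ℝ)-1)/((m:ℝ)+1)) * L := by
      rw [← Real.rpow_natCast, ← Real.rpow_mul hL.le]
      nth_rw 3 [← Real.rpow_one L]
      rw [← Real.rpow_add hL]
      congr 1
      rw [hc', hmd]; push_cast; field_simp; ring
    have e2 : (ψ x ^ (s-1))^2 * ψ x = ψ x ^ r := by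
      rw [← Real.rpow_natCast, ← Real.rpow_mul hψx.le]
      nth_rw 2 [← Real.rpow_one (ψ x)]
      rw [← Real.rpow_add hψx]
      congr 1
      rw [hs, hr']; push_cast; field_simp; ring
    have e3 : (2*(m:ℝ)/((m:ℝ)-1)) = 2 * s := by rw [hs, hmd]; ring_nf
    rw [e3]
    simp only [hf]
    rw [← e2]
    calc _ = (L ^ (1-c))^2 * s^2 * (ψ x ^ (s-1))^2 * (4 * ψ x * ((∑ k, Gφ x k ^ 2) + ε ^ 2 * ∑ k, GF x k ^ 2)) := by ring
      _ = _ := by rw [e1]; ring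
  · intro x k
    simp only [hfu, hU]
    have hd1 := ((hDφ x k).pow 2).add (((hDF x k).pow 2).const_mul (ε^2))
    have hd2 : HasDerivAt (fun t => ψ (Function.update x k t))
        (2 * φ x * Gφ x k + ε ^ 2 * (2 * F x * GF x k)) (x k) := by
      refine (hd1.congr_deriv ?_)
      simp
    have hd3 := hd2.rpow_const (p := s) (Or.inl (by simpa using (hψpos x).ne'))
    refine (hd3.const_mul (L ^ (1-c))).congr_deriv ?_
    simp
  · intro k x
    refine Integrable.mono' (integrable_inv_one_add_sq.const_mul ((L * (K + ε^2) ^ r) ^ (1-2*c)))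
      ?_ (Eventually.of_forall fun t => ?_)
    · refine Continuous.aestronglyMeasurable ?_
      refine Continuous.rpow_const (hfc.comp (Continuous.finInsertNth k continuous_id continuous_const)) ?_
      exact fun t => Or.inl (hfpos _).ne'
    · set z : Fin (m+1) → ℝ := Fin.insertNth k t x with hz
      rw [Real.norm_of_nonneg (Real.rpow_nonneg (hfpos _).le _)]
      have hc2 : 1 - 2 * c = d / (d+2) := by rw [hc']; field_simp; ring
      refine (Real.rpow_le_rpow (hfpos z).le (hfle z) (by rw [hc2]; positivity)).trans ?_
      rw [Real.mul_rpow (by positivity) (Real.rpow_nonneg (hSpos z).le _), ← Real.rpow_mul (hSpos z).le]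
      refine mul_le_mul_of_nonneg_left ?_ (by positivity)
      have he : -((m:ℝ)+1) * (1 - 2 * c) = -d := by rw [hc2, hmd]; field_simp; ring
      rw [he, Real.rpow_neg (hSpos z).le]
      have h1 : 1 + t^2 ≤ S z := by
        have := Finset.single_le_sum (f := fun k => z k ^ 2) (fun i _ => sq_nonneg _) (Finset.mem_univ k)
        simp only [hz, Fin.insertNth_apply_same] at this
        simp only [hS]
        linarith
      refine inv_anti₀ (by positivity) (h1.trans ?_)
      have h2 : 1 ≤ S z := by nlinarith [sq_nonneg t]
      calc S z = S z ^ (1:ℝ) := (Real.rpow_one _).symm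
        _ ≤ _ := Real.rpow_le_rpow_of_exponent_le h2 hd1


lemma ss_partial {n : ℕ} (h : EuclideanSpace ℝ (Fin n) → ℝ) (hd : Differentiable ℝ h)
    (x : Fin n → ℝ) (k : Fin n) :
    HasDerivAt (fun t => h (WithLp.toLp 2 (Function.update x k t)))
      (gradient h (WithLp.toLp 2 x) k) (x k) := by
  have h1 : HasDerivAt (fun t => (WithLp.toLp 2 (Function.update x k t) : EuclideanSpace ℝ (Fin n)))
      (EuclideanSpace.single k 1) (x k) := by
    have := ((PiLp.continuousLinearEquiv 2 ℝ (fun _ : Fin n => ℝ)).symm.toContinuousLinearMap.hasFDerivAt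
      (x := Function.update x k (x k))).comp_hasDerivAt (x k) (hasDerivAt_update x k (x k))
    exact this
  have h2 := (hd (WithLp.toLp 2 (Function.update x k (x k)))).hasFDerivAt.comp_hasDerivAt (x k) h1
  refine h2.congr_deriv ?_
  rw [Function.update_eq_self, ← inner_gradient_left, EuclideanSpace.inner_single_right]
  simp

lemma ss_bubble_grad {n : ℕ} (b : ℝ) (x : EuclideanSpace ℝ (Fin n)) :
    HasGradientAt (fun x : EuclideanSpace ℝ (Fin n) => (1 + ‖x‖ ^ 2) ^ (-b))
      ((-(2 * b) * (1 + ‖x‖ ^ 2) ^ (-b - 1)) • x) x := by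
  rw [hasGradientAt_iff_hasFDerivAt]
  have h1 := ((hasStrictFDerivAt_norm_sq x).hasFDerivAt.const_add 1).rpow_const (p := -b)
    (Or.inl (by positivity))
  refine h1.congr_fderiv ?_
  ext y
  simp
  ring

lemma ss_conv {n : ℕ} (h : EuclideanSpace ℝ (Fin n) → ℝ) (hm : Continuous h) (h0 : ∀ x, 0 ≤ h x)
    (hi : Integrable h) :
    ∫⁻ x : Fin n → ℝ, ENNReal.ofReal (h (WithLp.toLp 2 x)) = ENNReal.ofReal (∫ x, h x) := by
  rw [(PiLp.volume_preserving_toLp (Fin n)).lintegral_comp (f := fun x => ENNReal.ofReal (h x))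
    hm.measurable.ennreal_ofReal, ofReal_integral_eq_lintegral_ofReal hi (Eventually.of_forall h0)]

lemma ss_int_S {n : ℕ} (s : ℝ) (hs : (n:ℝ) < 2 * s) :
    Integrable (fun x : EuclideanSpace ℝ (Fin n) => (1 + ‖x‖ ^ 2) ^ (-s)) := by
  have := integrable_rpow_neg_one_add_norm_sq (E := EuclideanSpace ℝ (Fin n)) (μ := volume) (r := 2 * s) (by simpa using hs)
  convert this using 3
  ring

lemma ss_cont_S {n : ℕ} (s : ℝ) : Continuous (fun x : EuclideanSpace ℝ (Fin n) => (1 + ‖x‖ ^ 2) ^ (-s)) :=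
  Continuous.rpow_const (by fun_prop) fun x => Or.inl (by positivity)

lemma ss_int_M {m : ℕ} (hm : 2 ≤ m) :
    Integrable (fun x : EuclideanSpace ℝ (Fin (m+1)) => ‖x‖ ^ 2 * (1 + ‖x‖ ^ 2) ^ (-((m:ℝ)+1))) := by
  have hm' : (2:ℝ) ≤ m := by exact_mod_cast hm
  refine Integrable.mono' (ss_int_S (n := m+1) (m:ℝ) (by push_cast; linarith))
    (Continuous.aestronglyMeasurable ((by fun_prop : Continuous fun x : EuclideanSpace ℝ (Fin (m+1)) => ‖x‖^2).mul (ss_cont_S _)))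
    (Eventually.of_forall fun x => ?_)
  have hS : (0:ℝ) < 1 + ‖x‖ ^ 2 := by positivity
  rw [Real.norm_of_nonneg (by positivity)]
  calc _ ≤ (1 + ‖x‖^2) * (1 + ‖x‖ ^ 2) ^ (-((m:ℝ)+1)) := by gcongr; linarith
    _ = _ := by
      nth_rw 1 [← Real.rpow_one (1 + ‖x‖^2)]
      rw [← Real.rpow_add hS]; congr 1; ring

lemma ss_identity {m : ℕ} (hm : 2 ≤ m) :
    ((m:ℝ)+1) * ∫ x : EuclideanSpace ℝ (Fin (m+1)), (1 + ‖x‖ ^ 2) ^ (-(m:ℝ)) =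
      2 * m * ∫ x : EuclideanSpace ℝ (Fin (m+1)), ‖x‖ ^ 2 * (1 + ‖x‖ ^ 2) ^ (-((m:ℝ)+1)) := by
  have hm' : (2:ℝ) ≤ m := by exact_mod_cast hm
  have hfr : Module.finrank ℝ (EuclideanSpace ℝ (Fin (m+1))) = m + 1 := by simp
  have i1 := ss_int_S (n := m+1) (m:ℝ) (by push_cast; linarith)
  have i2 := ss_int_M hm
  have j1 := (integrable_fun_norm_addHaar (volume : Measure (EuclideanSpace ℝ (Fin (m+1))))
    (f := fun r => (1 + r ^ 2) ^ (-(m:ℝ)))).1 i1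
  have j2 := (integrable_fun_norm_addHaar (volume : Measure (EuclideanSpace ℝ (Fin (m+1))))
    (f := fun r => r ^ 2 * (1 + r ^ 2) ^ (-((m:ℝ)+1)))).1 i2
  rw [integral_fun_norm_addHaar volume (fun r => (1 + r ^ 2) ^ (-(m:ℝ))),
    integral_fun_norm_addHaar volume (fun r => r ^ 2 * (1 + r ^ 2) ^ (-((m:ℝ)+1)))]
  rw [hfr] at j1 j2 ⊢
  simp only [Nat.add_sub_cancel, smul_eq_mul] at j1 j2 ⊢
  have hder : ∀ y : ℝ, HasDerivAt (fun y : ℝ => y ^ (m+1) * (1 + y ^ 2) ^ (-(m:ℝ)))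
      (((m:ℝ)+1) * (y ^ m * (1 + y ^ 2) ^ (-(m:ℝ))) - 2 * m * (y ^ m * (y ^ 2 * (1 + y ^ 2) ^ (-((m:ℝ)+1))))) y := by
    intro y
    have h1 : HasDerivAt (fun y : ℝ => (1 + y ^ 2)) (2 * y) y := by
      simpa using (hasDerivAt_pow 2 y).const_add 1
    have h2 := h1.rpow_const (p := -(m:ℝ)) (Or.inl (by positivity))
    have h3 := (hasDerivAt_pow (m+1) y).mul h2
    refine h3.congr_deriv ?_
    have e : -(m:ℝ) - 1 = -((m:ℝ)+1) := by ring
    rw [e]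
    push_cast
    ring
  have hlim : Tendsto (fun y : ℝ => y ^ (m+1) * (1 + y ^ 2) ^ (-(m:ℝ))) atTop (𝓝 0) := by
    refine squeeze_zero' (g := fun y : ℝ => y⁻¹) ?_ ?_ tendsto_inv_atTop_zero
    · filter_upwards [eventually_ge_atTop 1] with y hy
      positivity
    · filter_upwards [eventually_ge_atTop 1] with y hy
      have hy0 : (0:ℝ) < y := by linarith
      rw [Real.rpow_neg (by positivity), Real.rpow_natCast, ← div_eq_mul_inv, div_le_iff₀ (by positivity)]
      rw [le_inv_mul_iff₀ hy0]
      calc y * y^(m+1) = y ^ (m+2) := by ring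
        _ ≤ y ^ (2 * m) := pow_le_pow_right₀ hy (by omega)
        _ = (y^2)^m := by rw [pow_mul]
        _ ≤ _ := by gcongr; linarith
  have hcont : Continuous (fun y : ℝ => y ^ (m+1) * (1 + y ^ 2) ^ (-(m:ℝ))) :=
    continuous_iff_continuousAt.2 fun y => (hder y).continuousAt
  have := integral_Ioi_of_hasDerivAt_of_tendsto (a := 0) hcont.continuousWithinAt (fun y _ => hder y)
    ((j1.const_mul _).sub (j2.const_mul _)) hlim
  rw [integral_sub (j1.const_mul _) (j2.const_mul _), integral_const_mul, integral_const_mul] at this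
  rw [zero_pow (by omega), zero_mul, sub_zero] at this
  simp only [nsmul_eq_mul]
  push_cast
  set V := (volume : Measure (EuclideanSpace ℝ (Fin (m+1)))).real (Metric.ball 0 1)
  linear_combination ((m:ℝ)+1) * V * this


theorem ss_eps {m : ℕ} (hm : 2 ≤ m) (φ : EuclideanSpace ℝ (Fin (m+1)) → ℝ)
    (hφ : ContDiff ℝ (⊤ : ℕ∞) φ) (hsupp : HasCompactSupport φ) (ε : ℝ) (hε : 0 < ε) :
    (∫ x, |φ x| ^ (2 * ((m:ℝ)+1) / ((m:ℝ)-1))) ^ (1 / (2 * ((m:ℝ)+1) / ((m:ℝ)-1))) *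
      (((m:ℝ)-1) * √(∫ x : EuclideanSpace ℝ (Fin (m+1)), ‖x‖ ^ 2 * (1 + ‖x‖ ^ 2) ^ (-((m:ℝ)+1)))) ≤
    (∫ x : EuclideanSpace ℝ (Fin (m+1)), (1 + ‖x‖ ^ 2) ^ (-((m:ℝ)+1))) ^ (1 / (2 * ((m:ℝ)+1) / ((m:ℝ)-1))) *
      √((∫ x, ‖gradient φ x‖ ^ 2) + ε ^ 2 * (((m:ℝ)-1)^2 *
        ∫ x : EuclideanSpace ℝ (Fin (m+1)), ‖x‖ ^ 2 * (1 + ‖x‖ ^ 2) ^ (-((m:ℝ)+1)))) := by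
  have hm' : (2:ℝ) ≤ m := by exact_mod_cast hm
  have hd0 : 0 < (m:ℝ) - 1 := by linarith
  set q : ℝ := 2 * ((m:ℝ)+1) / ((m:ℝ)-1) with hq
  have hq0 : 0 < q := by rw [hq]; positivity
  set r : ℝ := ((m:ℝ)+1)/((m:ℝ)-1) with hr
  have hr0 : 0 < r := by rw [hr]; positivity
  have hqr : q = 2 * r := by rw [hq, hr]; ring
  set M := ∫ x : EuclideanSpace ℝ (Fin (m+1)), ‖x‖ ^ 2 * (1 + ‖x‖ ^ 2) ^ (-((m:ℝ)+1)) with hM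
  set B := ∫ x : EuclideanSpace ℝ (Fin (m+1)), (1 + ‖x‖ ^ 2) ^ (-((m:ℝ)+1)) with hB
  set A := ∫ x : EuclideanSpace ℝ (Fin (m+1)), (1 + ‖x‖ ^ 2) ^ (-(m:ℝ)) with hA
  have hid : ((m:ℝ)+1) * A = 2 * m * M := ss_identity hm
  have iM := ss_int_M hm
  have iB := ss_int_S (n := m+1) ((m:ℝ)+1) (by push_cast; linarith)
  have iA := ss_int_S (n := m+1) (m:ℝ) (by push_cast; linarith)
  have hB0 : 0 < B := by
    refine integral_pos_of_integrable_nonneg_nonzero (x := 0) (ss_cont_S _) iB (fun x => ?_) (by simp)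
    simp only [Pi.zero_apply]; positivity
  have hA0 : 0 < A := by
    refine integral_pos_of_integrable_nonneg_nonzero (x := 0) (ss_cont_S _) iA (fun x => ?_) (by simp)
    simp only [Pi.zero_apply]; positivity
  have hM0 : 0 < M := by
    have : 0 < 2 * (m:ℝ) * M := by rw [← hid]; positivity
    exact pos_of_mul_pos_right this (by positivity)
  -- the bubble
  set F : EuclideanSpace ℝ (Fin (m+1)) → ℝ := fun x => (1 + ‖x‖ ^ 2) ^ (-(((m:ℝ)-1)/2)) with hF
  have hFc : Continuous F := ss_cont_S _
  have hFg : ∀ x, gradient F x = (-((m:ℝ)-1) * (1 + ‖x‖ ^ 2) ^ (-(((m:ℝ)+1)/2))) • x := fun x => by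
    rw [(ss_bubble_grad (((m:ℝ)-1)/2) x).gradient]
    congr 2
    · ring
    · congr 1; ring
  have hFd : Differentiable ℝ F := fun x => (ss_bubble_grad (((m:ℝ)-1)/2) x).differentiableAt
  have hFgn : ∀ x, ‖gradient F x‖ ^ 2 = ((m:ℝ)-1)^2 * (‖x‖ ^ 2 * (1 + ‖x‖ ^ 2) ^ (-((m:ℝ)+1))) := fun x => by
    have hS : (0:ℝ) < 1 + ‖x‖ ^ 2 := by positivity
    rw [hFg, norm_smul, mul_pow, Real.norm_eq_abs, sq_abs, mul_pow, ← Real.rpow_natCast (_ ^ _), ← Real.rpow_mul hS.le]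
    have : -(((m:ℝ)+1)/2) * ((2:ℕ):ℝ) = -((m:ℝ)+1) := by push_cast; ring
    rw [this]; ring
  have hF2 : ∀ x, F x ^ 2 = (1 + ‖x‖ ^ 2) ^ (-((m:ℝ)-1)) := fun x => by
    have hS : (0:ℝ) < 1 + ‖x‖ ^ 2 := by positivity
    simp only [hF]
    rw [← Real.rpow_natCast, ← Real.rpow_mul hS.le]
    congr 1; push_cast; ring
  have hF2pos : ∀ x, 0 < F x ^ 2 := fun x => by rw [hF2]; positivity
  have hFgc : Continuous (gradient F) := by
    rw [show gradient F = _ from funext hFg]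
    exact (continuous_const.mul (ss_cont_S _)).smul continuous_id
  have hφd : Differentiable ℝ φ := hφ.differentiable (by simp)
  have hφc : Continuous φ := hφ.continuous
  have hφgc : Continuous (gradient φ) := by
    have h1 : Continuous (fderiv ℝ φ) := hφ.continuous_fderiv (by simp)
    exact (InnerProductSpace.toDual ℝ _).symm.continuous.comp h1
  have iK : Integrable fun x => ‖gradient φ x‖ ^ 2 := by
    refine Continuous.integrable_of_hasCompactSupport (by fun_prop) ?_
    have h1 : HasCompactSupport (fderiv ℝ φ) := hsupp.fderiv ℝ
    refine h1.mono' ?_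
    intro x hx
    refine subset_tsupport _ ?_
    rw [Function.mem_support] at hx ⊢
    intro h
    apply hx
    rw [gradient, h]; simp
  set Kφ := ∫ x, ‖gradient φ x‖ ^ 2 with hKφ
  -- domination
  obtain ⟨K, hK0, hK⟩ : ∃ K : ℝ, 0 ≤ K ∧ ∀ x, φ x ^ 2 ≤ K * F x ^ 2 := by
    have hcs : HasCompactSupport fun x => φ x ^ 2 / F x ^ 2 := by
      refine hsupp.mono' ?_
      intro x hx
      refine subset_tsupport _ ?_
      rw [Function.mem_support] at hx ⊢
      intro h; apply hx; simp [h]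
    have hcc : Continuous fun x => φ x ^ 2 / F x ^ 2 :=
      (hφc.pow 2).div (hFc.pow 2) fun x => (hF2pos x).ne'
    obtain ⟨C, hC⟩ := hcs.exists_bound_of_continuous hcc
    refine ⟨C, (norm_nonneg _).trans (hC 0), fun x => ?_⟩
    have := hC x
    rw [Real.norm_of_nonneg (by positivity), div_le_iff₀ (hF2pos x)] at this
    exact this
  set ψ : EuclideanSpace ℝ (Fin (m+1)) → ℝ := fun x => φ x ^ 2 + ε ^ 2 * F x ^ 2 with hψ
  have hψpos : ∀ x, 0 < ψ x := fun x => by have := hF2pos x; simp only [hψ]; positivity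
  have hψc : Continuous fun x => ψ x ^ r :=
    Continuous.rpow_const (by simp only [hψ]; fun_prop) fun x => Or.inl (hψpos x).ne'
  have hψle : ∀ x, ψ x ^ r ≤ (K + ε^2) ^ r * (1 + ‖x‖ ^ 2) ^ (-((m:ℝ)+1)) := fun x => by
    have hS : (0:ℝ) < 1 + ‖x‖ ^ 2 := by positivity
    have h1 : ψ x ≤ (K + ε^2) * F x ^ 2 := by
      have := hK x
      simp only [hψ]; nlinarith
    refine (Real.rpow_le_rpow (hψpos x).le h1 hr0.le).trans_eq ?_
    rw [Real.mul_rpow (by positivity) (hF2pos x).le, hF2, ← Real.rpow_mul hS.le]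
    congr 2
    rw [hr]; field_simp
  have iψ : Integrable fun x => ψ x ^ r := by
    refine Integrable.mono' (iB.const_mul ((K + ε^2) ^ r)) hψc.aestronglyMeasurable (Eventually.of_forall fun x => ?_)
    rw [Real.norm_of_nonneg (Real.rpow_nonneg (hψpos x).le _)]
    exact hψle x
  set J := ∫ x, ψ x ^ r with hJ
  have hJ0 : 0 < J :=
    integral_pos_of_integrable_nonneg_nonzero (x := 0) hψc iψ
      (fun x => Real.rpow_nonneg (hψpos x).le _) (Real.rpow_pos_of_pos (hψpos 0) _).ne'
  set I := ∫ x, |φ x| ^ q with hI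
  have hI0 : 0 ≤ I := integral_nonneg fun x => by positivity
  have hIJ : I ≤ J := by
    refine integral_mono_of_nonneg (Eventually.of_forall fun x => by positivity) iψ (Eventually.of_forall fun x => ?_)
    simp only
    rw [hqr, Real.rpow_mul (abs_nonneg _)]
    refine Real.rpow_le_rpow (by positivity) ?_ hr0.le
    rw [Real.rpow_two, sq_abs]
    simp only [hψ]
    have := hF2pos x
    nlinarith [mul_pos (pow_pos hε 2) this]
  set L := B / J with hL
  have hL0 : 0 < L := div_pos hB0 hJ0
  have hnorm : ∀ x : Fin (m+1) → ℝ, ∑ k, x k ^ 2 = ‖(WithLp.toLp 2 x : EuclideanSpace ℝ (Fin (m+1)))‖ ^ 2 := fun x => by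
    rw [EuclideanSpace.real_norm_sq_eq]
  have htoLp : Continuous (fun x : Fin (m+1) → ℝ => (WithLp.toLp 2 x : EuclideanSpace ℝ (Fin (m+1)))) :=
    PiLp.continuous_toLp 2 _
  have hofLp : Continuous (fun x : EuclideanSpace ℝ (Fin (m+1)) => (WithLp.ofLp x : Fin (m+1) → ℝ)) :=
    PiLp.continuous_ofLp 2 _
  have cB := ss_conv _ (ss_cont_S (n := m+1) ((m:ℝ)+1)) (fun x => by positivity) iB
  have cA := ss_conv _ (ss_cont_S (n := m+1) (m:ℝ)) (fun x => by positivity) iA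
  have cM := ss_conv (fun x : EuclideanSpace ℝ (Fin (m+1)) => ‖x‖ ^ 2 * (1 + ‖x‖ ^ 2) ^ (-((m:ℝ)+1))) ((by fun_prop : Continuous fun x : EuclideanSpace ℝ (Fin (m+1)) => ‖x‖^2).mul (ss_cont_S (n := m+1) ((m:ℝ)+1)))
    (fun x => by positivity) iM
  have cJ := ss_conv (fun x => L * ψ x ^ r) (continuous_const.mul hψc) (fun x => mul_nonneg hL0.le (Real.rpow_nonneg (hψpos x).le _)) (iψ.const_mul L)
  have iKK : Integrable fun x => L ^ (((m:ℝ)-1)/((m:ℝ)+1)) * (2*(m:ℝ)/((m:ℝ)-1))^2 *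
      (‖gradient φ x‖ ^ 2 + ε ^ 2 * ‖gradient F x‖^2) := by
    refine (iK.add (Integrable.const_mul ?_ _)).const_mul _
    simp only [hFgn]
    exact iM.const_mul _
  have cK := ss_conv _ (by fun_prop) (fun x => by positivity) iKK
  have key := ss_pi_eps hm (fun x => φ (WithLp.toLp 2 x)) (fun x => F (WithLp.toLp 2 x))
    (fun x => WithLp.ofLp (gradient φ (WithLp.toLp 2 x : EuclideanSpace ℝ (Fin (m+1))))) (fun x => WithLp.ofLp (gradient F (WithLp.toLp 2 x : EuclideanSpace ℝ (Fin (m+1)))))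
    (hφc.comp htoLp) (hFc.comp htoLp) (hofLp.comp (hφgc.comp htoLp)) (hofLp.comp (hFgc.comp htoLp))
    (fun x k => ss_partial φ hφd x k) (fun x k => ss_partial F hFd x k)
    (fun x => by rw [hF2, hnorm]) K hK0 (fun x => hK _) ε hε L hL0
    (by
      simp only [hnorm]
      rw [cB]
      refine cJ.trans ?_
      rw [integral_const_mul, ← hJ, hL, div_mul_cancel₀ _ hJ0.ne'])
    (by simp only [hnorm]; rw [cM]; exact ENNReal.ofReal_ne_top)
  simp only [hnorm, WithLp.toLp_ofLp] at key
  rw [cA, cM, cK] at key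
  have hKφ0 : 0 ≤ Kφ := integral_nonneg fun x => by positivity
  have eK : (∫ x, L ^ (((m:ℝ)-1)/((m:ℝ)+1)) * (2*(m:ℝ)/((m:ℝ)-1))^2 *
      (‖gradient φ x‖ ^ 2 + ε ^ 2 * ‖gradient F x‖^2)) =
      L ^ (((m:ℝ)-1)/((m:ℝ)+1)) * (2*(m:ℝ)/((m:ℝ)-1))^2 * (Kφ + ε^2 * (((m:ℝ)-1)^2 * M)) := by
    rw [integral_const_mul]
    simp only [hFgn]
    rw [integral_add iK ((iM.const_mul _).const_mul _), integral_const_mul, integral_const_mul]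
  rw [eK, ENNReal.ofReal_rpow_of_nonneg (by positivity) (by norm_num),
    ENNReal.ofReal_rpow_of_nonneg hM0.le (by norm_num), ← ENNReal.ofReal_natCast,
    ← ENNReal.ofReal_mul (by positivity), ← ENNReal.ofReal_mul (by positivity),
    ENNReal.ofReal_le_ofReal_iff (by positivity), ← Real.sqrt_eq_rpow, ← Real.sqrt_eq_rpow] at key
  push_cast at key
  set W := Kφ + ε^2 * (((m:ℝ)-1)^2 * M) with hW
  have hW0 : 0 ≤ W := by positivity
  rw [hid, Real.sqrt_mul (by positivity), Real.sqrt_mul (by positivity), Real.sqrt_sq (by positivity)] at key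
  have hexp : √(L ^ (((m:ℝ)-1)/((m:ℝ)+1))) = L ^ (1/q) := by
    rw [Real.sqrt_eq_rpow, ← Real.rpow_mul hL0.le]
    congr 1
    rw [hq]; field_simp
  rw [hexp] at key
  have hsM : 0 < √M := Real.sqrt_pos.2 hM0
  have key2 : ((m:ℝ)-1) * √M ≤ L ^ (1/q) * √W := by
    have h1 : M = √M * √M := (Real.mul_self_sqrt hM0.le).symm
    have h2 : 2 * (m:ℝ) * √M * √M ≤ L ^ (1/q) * (2*(m:ℝ)/((m:ℝ)-1)) * √W * √M := by
      calc _ = 2 * (m:ℝ) * M := by rw [mul_assoc, ← h1]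
        _ ≤ _ := key
    have h3 := le_of_mul_le_mul_right h2 hsM
    have h4 : L ^ (1/q) * (2*(m:ℝ)/((m:ℝ)-1)) * √W = (2 * (m:ℝ)) * (L ^ (1/q) * √W) / ((m:ℝ)-1) := by ring
    rw [h4, le_div_iff₀ hd0] at h3
    have : (2 * (m:ℝ)) * (((m:ℝ)-1) * √M) ≤ (2 * (m:ℝ)) * (L ^ (1/q) * √W) := by linarith
    exact le_of_mul_le_mul_left this (by positivity)
  have hLJ : L ^ (1/q) * J ^ (1/q) = B ^ (1/q) := by
    rw [← Real.mul_rpow hL0.le hJ0.le, hL, div_mul_cancel₀ _ hJ0.ne']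
  calc I ^ (1/q) * (((m:ℝ)-1) * √M) ≤ J ^ (1/q) * (L ^ (1/q) * √W) := by
        refine mul_le_mul (Real.rpow_le_rpow hI0 hIJ (by positivity)) key2 (by positivity) (by positivity)
    _ = B ^ (1/q) * √W := by rw [← hLJ]; ring

theorem ss_final {m : ℕ} (hm : 2 ≤ m) (φ : EuclideanSpace ℝ (Fin (m+1)) → ℝ)
    (hφ : ContDiff ℝ (⊤ : ℕ∞) φ) (hsupp : HasCompactSupport φ) :
    (∫ x, |φ x| ^ (2 * ((m:ℝ)+1) / ((m:ℝ)-1))) ^ (1 / (2 * ((m:ℝ)+1) / ((m:ℝ)-1))) *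
      (((m:ℝ)-1) * √(∫ x : EuclideanSpace ℝ (Fin (m+1)), ‖x‖ ^ 2 * (1 + ‖x‖ ^ 2) ^ (-((m:ℝ)+1)))) ≤
    (∫ x : EuclideanSpace ℝ (Fin (m+1)), (1 + ‖x‖ ^ 2) ^ (-((m:ℝ)+1))) ^ (1 / (2 * ((m:ℝ)+1) / ((m:ℝ)-1))) *
      √(∫ x, ‖gradient φ x‖ ^ 2) := by
  set R := (∫ x : EuclideanSpace ℝ (Fin (m+1)), (1 + ‖x‖ ^ 2) ^ (-((m:ℝ)+1))) ^ (1 / (2 * ((m:ℝ)+1) / ((m:ℝ)-1)))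
  set K := ∫ x, ‖gradient φ x‖ ^ 2
  set T := ((m:ℝ)-1)^2 *
        ∫ x : EuclideanSpace ℝ (Fin (m+1)), ‖x‖ ^ 2 * (1 + ‖x‖ ^ 2) ^ (-((m:ℝ)+1)) with hT
  have hc : Continuous fun ε : ℝ => R * √(K + ε ^ 2 * T) := by fun_prop
  have ht : Filter.Tendsto (fun ε : ℝ => R * √(K + ε ^ 2 * T)) (nhdsWithin 0 (Set.Ioi 0)) (nhds (R * √K)) := by
    have := (hc.tendsto 0).mono_left (nhdsWithin_le_nhds (s := Set.Ioi (0:ℝ)))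
    simpa using this
  refine ge_of_tendsto ht ?_
  filter_upwards [self_mem_nhdsWithin] with ε hε
  exact ss_eps hm φ hφ hsupp ε hε

theorem ss_M_pos {m : ℕ} (hm : 2 ≤ m) :
    0 < ∫ x : EuclideanSpace ℝ (Fin (m+1)), ‖x‖ ^ 2 * (1 + ‖x‖ ^ 2) ^ (-((m:ℝ)+1)) := by
  have hm' : (2:ℝ) ≤ m := by exact_mod_cast hm
  have hid := ss_identity hm
  have iA := ss_int_S (n := m+1) (m:ℝ) (by push_cast; linarith)
  have hA0 : 0 < ∫ x : EuclideanSpace ℝ (Fin (m+1)), (1 + ‖x‖ ^ 2) ^ (-(m:ℝ)) := by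
    refine integral_pos_of_integrable_nonneg_nonzero (x := 0) (ss_cont_S _) iA (fun x => ?_) (by simp)
    simp only [Pi.zero_apply]; positivity
  have : 0 < ((m:ℝ)+1) * ∫ x : EuclideanSpace ℝ (Fin (m+1)), (1 + ‖x‖ ^ 2) ^ (-(m:ℝ)) := by positivity
  rw [hid] at this
  exact pos_of_mul_pos_right this (by positivity)

end SSHelpers

/-- **Sharp Sobolev inequality.** For integer `N ≥ 3` and every smooth compactly
supported `φ : ℝᴺ → ℝ`, `‖φ‖_{2N/(N−2)} ≤ C_N ‖∇φ‖₂` where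
`C_N = ‖F_{1,0}‖_{2N/(N−2)} / ‖∇F_{1,0}‖₂`. -/
theorem sharp_sobolev_inequality (N : ℕ) (hN : 3 ≤ N)
    (φ : EuclideanSpace ℝ (Fin N) → ℝ)
    (hφ_smooth : ContDiff ℝ (⊤ : ℕ∞) φ) (hφ_supp : HasCompactSupport φ) :
    LqNorm N (2 * N / ((N : ℝ) - 2)) φ ≤
      (LqNorm N (2 * N / ((N : ℝ) - 2)) (sobolevBubble N 1 0) /
          gradL2 N (sobolevBubble N 1 0)) * gradL2 N φ := by
  obtain ⟨m, rfl⟩ : ∃ m, N = m + 1 := ⟨N - 1, by omega⟩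
  have hm : 2 ≤ m := by omega
  have hm' : (2:ℝ) ≤ m := by exact_mod_cast hm
  have hd0 : 0 < (m:ℝ) - 1 := by linarith
  have h2 : (((m + 1 : ℕ) : ℝ) - 2) = (m:ℝ) - 1 := by push_cast; ring
  have h3 : ((m + 1 : ℕ) : ℝ) = (m:ℝ) + 1 := by push_cast; ring
  have hbub : sobolevBubble (m+1) 1 0 =
      fun x : EuclideanSpace ℝ (Fin (m+1)) => (1 + ‖x‖ ^ 2) ^ (-(((m:ℝ)-1)/2)) := by
    funext x
    have hS : (0:ℝ) < 1 + ‖x‖ ^ 2 := by positivity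
    simp only [sobolevBubble, h2, sub_zero, one_pow, one_mul, one_div]
    rw [Real.inv_rpow hS.le, Real.rpow_neg hS.le]
  have hM0 := ss_M_pos hm
  have hg : gradL2 (m+1) (sobolevBubble (m+1) 1 0) = ((m:ℝ)-1) *
      √(∫ x : EuclideanSpace ℝ (Fin (m+1)), ‖x‖ ^ 2 * (1 + ‖x‖ ^ 2) ^ (-((m:ℝ)+1))) := by
    rw [hbub, gradL2]
    have : ∀ x : EuclideanSpace ℝ (Fin (m+1)), ‖gradient (fun x : EuclideanSpace ℝ (Fin (m+1)) =>
        (1 + ‖x‖ ^ 2) ^ (-(((m:ℝ)-1)/2))) x‖ ^ 2 =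
        ((m:ℝ)-1)^2 * (‖x‖ ^ 2 * (1 + ‖x‖ ^ 2) ^ (-((m:ℝ)+1))) := fun x => by
      have hS : (0:ℝ) < 1 + ‖x‖ ^ 2 := by positivity
      rw [(ss_bubble_grad (((m:ℝ)-1)/2) x).gradient, norm_smul, mul_pow, Real.norm_eq_abs, sq_abs,
        mul_pow, ← Real.rpow_natCast (_ ^ _), ← Real.rpow_mul hS.le]
      have : (-(((m:ℝ)-1)/2) - 1) * ((2:ℕ):ℝ) = -((m:ℝ)+1) := by push_cast; ring
      rw [this]; ring
    simp only [this]
    rw [integral_const_mul, Real.sqrt_mul (by positivity), Real.sqrt_sq hd0.le]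
  have hB : LqNorm (m+1) (2 * ((m:ℝ)+1) / ((m:ℝ)-1)) (sobolevBubble (m+1) 1 0) =
      (∫ x : EuclideanSpace ℝ (Fin (m+1)), (1 + ‖x‖ ^ 2) ^ (-((m:ℝ)+1))) ^
        (1 / (2 * ((m:ℝ)+1) / ((m:ℝ)-1))) := by
    rw [hbub, LqNorm]
    have : ∀ x : EuclideanSpace ℝ (Fin (m+1)), |(1 + ‖x‖ ^ 2) ^ (-(((m:ℝ)-1)/2))| ^
        (2 * ((m:ℝ)+1) / ((m:ℝ)-1)) = (1 + ‖x‖ ^ 2) ^ (-((m:ℝ)+1)) := fun x => by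
      have hS : (0:ℝ) < 1 + ‖x‖ ^ 2 := by positivity
      rw [abs_of_pos (by positivity), ← Real.rpow_mul hS.le]
      congr 1
      field_simp
    simp only [this]
  rw [h2, h3, hB, hg, div_mul_eq_mul_div, le_div_iff₀ (by positivity)]
  exact ss_final hm φ hφ_smooth hφ_supp
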